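/- Let x₁,…,x_N ∈ [0,1]^d be fixed points and let W ⊆ {1,…,d} with |W| = q. Let ζ ∈ ℝ^d be the random key with ζ_i i.i.d. uniform on {−1,+1} for i ∈ W and ζ_i = 0 for i ∉ W, define the watermark δ^w by δ^w_i = ε_w ζ_i for i ∈ W and 0 otherwise, let the poisons δ^p_1,…,δ^p_N be arbitrary vectors supported on the complement of W with ∥δ^p_j∥_∞ ≤ ε_p, and set δ_j = δ^p_j + δ^w. If q > (4/ε_w²)·log(N/ω), then with probability at least 1 − ω over ζ, for all i, j ∈ {1,…,N} one has ζᵀ(x_j + δ_j) > ζᵀx_i. -/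

import Mathlib

open MeasureTheory

/-- The uniform measure on `{-1, 1} ⊆ ℝ`. -/
noncomputable def signMeasure : Measure ℝ :=
  (1/2 : ENNReal) • Measure.dirac (-1 : ℝ) + (1/2 : ENNReal) • Measure.dirac (1 : ℝ)

/-- The law of a key on `ℝ^d` that is i.i.d. uniform `±1` on the index set `W`
and zero off `W`. -/
noncomputable def keyMeasureOn (d : ℕ) (W : Finset (Fin d)) : Measure (Fin d → ℝ) :=
  Measure.pi fun i => if i ∈ W then signMeasure else Measure.dirac (0 : ℝ)

lemma signMeasure_isProbabilityMeasure : IsProbabilityMeasure signMeasure where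
  measure_univ := by
    simp [signMeasure, ENNReal.inv_two_add_inv_two]

lemma signMeasure_ae : ∀ᵐ t ∂signMeasure, t = -1 ∨ t = 1 := by
  rw [signMeasure, ae_add_measure_iff]
  constructor
  · refine Measure.ae_smul_measure ?_ _
    rw [ae_dirac_eq]
    exact Or.inl rfl
  · refine Measure.ae_smul_measure ?_ _
    rw [ae_dirac_eq]
    exact Or.inr rfl

lemma integral_id_signMeasure : ∫ t, t ∂signMeasure = 0 := by
  rw [signMeasure, integral_add_measure, integral_smul_measure, integral_smul_measure,
    integral_dirac, integral_dirac]
  · simp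
  · exact (integrable_dirac (by simp)).smul_measure (by simp)
  · exact (integrable_dirac (by simp)).smul_measure (by simp)

lemma isProbabilityMeasure_key_marginal {d : ℕ} (W : Finset (Fin d)) (i : Fin d) :
    IsProbabilityMeasure (if i ∈ W then signMeasure else Measure.dirac (0 : ℝ)) := by
  split_ifs
  · exact signMeasure_isProbabilityMeasure
  · infer_instance

lemma keyMeasureOn_isProbabilityMeasure (d : ℕ) (W : Finset (Fin d)) :
    IsProbabilityMeasure (keyMeasureOn d W) := by
  have := isProbabilityMeasure_key_marginal W
  unfold keyMeasureOn
  infer_instance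

lemma measurePreserving_eval_keyMeasureOn {d : ℕ} (W : Finset (Fin d)) (k : Fin d) :
    MeasurePreserving (Function.eval k) (keyMeasureOn d W)
      (if k ∈ W then signMeasure else Measure.dirac (0 : ℝ)) := by
  have := isProbabilityMeasure_key_marginal W
  exact measurePreserving_eval
    (fun i => if i ∈ W then signMeasure else Measure.dirac (0 : ℝ)) k

/-- Almost surely, a key is `±1` on `W` and vanishes off `W`. -/
lemma keyMeasureOn_ae {d : ℕ} (W : Finset (Fin d)) :
    ∀ᵐ ζ ∂keyMeasureOn d W, ∀ k, (k ∈ W → ζ k = -1 ∨ ζ k = 1) ∧ (k ∉ W → ζ k = 0) := by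
  rw [ae_all_iff]
  intro k
  have hp := measurePreserving_eval_keyMeasureOn W k
  by_cases hk : k ∈ W
  · rw [if_pos hk] at hp
    filter_upwards [hp.quasiMeasurePreserving.ae signMeasure_ae] with ζ hζ
    exact ⟨fun _ => hζ, fun h => absurd hk h⟩
  · rw [if_neg hk] at hp
    have h0 : ∀ᵐ t ∂Measure.dirac (0 : ℝ), t = 0 := by
      rw [ae_dirac_eq]
      exact rfl
    filter_upwards [hp.quasiMeasurePreserving.ae h0] with ζ hζ
    exact ⟨fun h => absurd h hk, fun _ => hζ⟩

lemma integral_eval_keyMeasureOn {d : ℕ} {W : Finset (Fin d)} {k : Fin d} (hk : k ∈ W) :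
    ∫ ζ, ζ k ∂keyMeasureOn d W = 0 := by
  have hp := measurePreserving_eval_keyMeasureOn W k
  rw [if_pos hk] at hp
  have := integral_map (μ := keyMeasureOn d W) (φ := Function.eval k) (f := fun t : ℝ => t)
    hp.measurable.aemeasurable aestronglyMeasurable_id
  rw [hp.map_eq, integral_id_signMeasure] at this
  exact this.symm

lemma iIndepFun_keyMeasureOn {d : ℕ} (W : Finset (Fin d)) (a : Fin d → ℝ) :
    ProbabilityTheory.iIndepFun (fun k (ζ : Fin d → ℝ) => ζ k * a k) (keyMeasureOn d W) := by
  have := isProbabilityMeasure_key_marginal W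
  exact ProbabilityTheory.iIndepFun_pi (X := fun k (t : ℝ) => t * a k)
    (fun k => (measurable_id.mul_const _).aemeasurable)

/-- Hoeffding's inequality for the correlation of a key with a vector bounded by `1`. -/
lemma keyMeasureOn_real_sum_ge_le {d : ℕ} (W : Finset (Fin d)) (a : Fin d → ℝ)
    (ha : ∀ k, |a k| ≤ 1) {t : ℝ} (ht : 0 ≤ t) :
    (keyMeasureOn d W).real {ζ | t ≤ ∑ k ∈ W, ζ k * a k} ≤
      Real.exp (-t ^ 2 / (2 * W.card)) := by
  have := keyMeasureOn_isProbabilityMeasure d W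
  have hsub : ∀ k ∈ W, ProbabilityTheory.HasSubgaussianMGF
      (fun ζ : Fin d → ℝ => ζ k * a k) 1 (keyMeasureOn d W) := by
    intro k hk
    have h := ProbabilityTheory.hasSubgaussianMGF_of_mem_Icc_of_integral_eq_zero
      (μ := keyMeasureOn d W) (X := fun ζ : Fin d → ℝ => ζ k * a k) (a := -1) (b := 1)
      ((measurable_pi_apply k).mul_const _).aemeasurable ?_ ?_
    · have hc : (‖(1 : ℝ) - -1‖₊ / 2) ^ 2 = 1 := by
        ext
        norm_num
      rwa [hc] at h
    · filter_upwards [keyMeasureOn_ae W] with ζ hζ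
      have := abs_le.1 (ha k)
      rcases (hζ k).1 hk with h | h <;> rw [h] <;> constructor <;> linarith
    · rw [integral_mul_const, integral_eval_keyMeasureOn hk, zero_mul]
  simpa using ProbabilityTheory.HasSubgaussianMGF.measure_sum_ge_le_of_iIndepFun
    (iIndepFun_keyMeasureOn W a) hsub ht

/-- Correlating a key with a watermarked, poisoned sample. -/
lemma sum_key_mul_watermarked {d : ℕ} {W : Finset (Fin d)} {ζ : Fin d → ℝ} (ε : ℝ)
    (hζ : ∀ k, (k ∈ W → ζ k = -1 ∨ ζ k = 1) ∧ (k ∉ W → ζ k = 0))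
    (x y p : Fin d → ℝ) (hp : ∀ k ∈ W, p k = 0) :
    ∑ k, ζ k * (x k + (p k + (if k ∈ W then ε * ζ k else 0))) - ∑ k, ζ k * y k =
      W.card * ε - ∑ k ∈ W, ζ k * (y k - x k) := by
  rw [← Finset.sum_sub_distrib, ← Finset.sum_subset (Finset.subset_univ W)]
  · rw [← nsmul_eq_mul, ← Finset.sum_const, ← Finset.sum_sub_distrib]
    refine Finset.sum_congr rfl fun k hk => ?_
    rw [if_pos hk, hp k hk]
    rcases (hζ k).1 hk with h | h <;> rw [h] <;> ring
  · intro k _ hk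
    rw [(hζ k).2 hk]
    ring

lemma sq_mul_exp_le {N q : ℕ} {ε ω : ℝ} (hN : 0 < N) (hε : 0 < ε) (hω0 : 0 < ω) (hω1 : ω < 1)
    (hq : (q : ℝ) > (4 / ε ^ 2) * Real.log ((N : ℝ) / ω)) :
    (N : ℝ) * (N * Real.exp (-(q * ε) ^ 2 / (2 * q))) ≤ ω := by
  have hN' : (1 : ℝ) ≤ N := by exact_mod_cast hN
  have hr : 1 < (N : ℝ) / ω := by
    rw [lt_div_iff₀ hω0]
    linarith
  have hlog := Real.log_pos hr
  have hq0 : (0 : ℝ) < q := lt_trans (by positivity) hq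
  have h4 : 4 * Real.log ((N : ℝ) / ω) < q * ε ^ 2 := by
    rw [gt_iff_lt, div_mul_eq_mul_div, div_lt_iff₀ (by positivity)] at hq
    exact hq
  have hexp : Real.exp (-(q * ε) ^ 2 / (2 * q)) ≤ (ω / N) ^ 2 := by
    have h1 : -(q * ε) ^ 2 / (2 * q) = -(q * ε ^ 2 / 2) := by
      field_simp
    have h2 : (ω / N) ^ 2 = Real.exp (-(2 * Real.log ((N : ℝ) / ω))) := by
      rw [← inv_div, inv_pow, Real.exp_neg, two_mul, Real.exp_add,
        Real.exp_log (by linarith), sq]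
    rw [h1, h2, Real.exp_le_exp]
    linarith
  calc (N : ℝ) * (N * Real.exp (-(q * ε) ^ 2 / (2 * q)))
      ≤ N * (N * (ω / N) ^ 2) := by gcongr
    _ = ω ^ 2 := by field_simp
    _ ≤ ω := by nlinarith

/-- Proposition 4.8: universal, poisoning-concurrent watermarking on a finite dataset. -/
theorem universal_poisoning_concurrent_watermarking
    (d q N : ℕ) (εw εp ω : ℝ) (hεw : 0 < εw) (hεp : 0 < εp)
    (hω0 : 0 < ω) (hω1 : ω < 1)
    (W : Finset (Fin d)) (hW : W.card = q)
    (x : Fin N → Fin d → ℝ) (hx : ∀ j i, x j i ∈ Set.Icc (0:ℝ) 1)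
    (δp : Fin N → Fin d → ℝ) (hδp : ∀ j i, |δp j i| ≤ εp)
    (hδpW : ∀ j i, i ∈ W → δp j i = 0)
    (hq : (q : ℝ) > (4 / εw ^ 2) * Real.log ((N : ℝ) / ω)) :
    ((keyMeasureOn d W)
      {ζ | ∀ i j : Fin N,
          (∑ k, ζ k * (x j k + (δp j k + (if k ∈ W then εw * ζ k else 0))))
            > ∑ k, ζ k * x i k}).toReal ≥ 1 - ω := by
  have := keyMeasureOn_isProbabilityMeasure d W
  rcases Nat.eq_zero_or_pos N with rfl | hN
  · simp [hω0.le]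
  set G := {ζ : Fin d → ℝ | ∀ i j : Fin N,
    (∑ k, ζ k * (x j k + (δp j k + (if k ∈ W then εw * ζ k else 0)))) > ∑ k, ζ k * x i k}
  set B : Fin N → Fin N → Set (Fin d → ℝ) := fun i j =>
    {ζ | q * εw ≤ ∑ k ∈ W, ζ k * (x i k - x j k)} with hB
  have hBm : ∀ i j, (keyMeasureOn d W).real (B i j) ≤ Real.exp (-(q * εw) ^ 2 / (2 * q)) := by
    intro i j
    have h := keyMeasureOn_real_sum_ge_le W (fun k => x i k - x j k)
      (fun k => abs_le.2 ⟨by linarith [(hx i k).1, (hx j k).2],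
        by linarith [(hx i k).2, (hx j k).1]⟩) (t := q * εw) (by positivity)
    rwa [hW] at h
  have hcover : ∀ᵐ ζ ∂keyMeasureOn d W, ζ ∈ (Set.univ : Set (Fin d → ℝ)) →
      ζ ∈ G ∪ ⋃ i, ⋃ j, B i j := by
    filter_upwards [keyMeasureOn_ae W] with ζ hζ _
    by_contra hc
    simp only [Set.mem_union, Set.mem_iUnion, not_or, not_exists] at hc
    refine hc.1 fun i j => ?_
    have h1 := hc.2 i j
    simp only [hB, Set.mem_ofPred_eq, not_le] at h1
    have h2 := sum_key_mul_watermarked εw hζ (x j) (x i) (δp j) (hδpW j)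
    rw [hW] at h2
    linarith
  have hle : (1 : ℝ) ≤ (keyMeasureOn d W).real (G ∪ ⋃ i, ⋃ j, B i j) := by
    rw [← probReal_univ (μ := keyMeasureOn d W)]
    exact ENNReal.toReal_mono (measure_ne_top _ _) (measure_mono_ae hcover)
  have hbad : (keyMeasureOn d W).real (⋃ i, ⋃ j, B i j) ≤ ω := by
    calc (keyMeasureOn d W).real (⋃ i, ⋃ j, B i j)
        ≤ ∑ i, (keyMeasureOn d W).real (⋃ j, B i j) := measureReal_iUnion_fintype_le _
      _ ≤ ∑ i, ∑ j, (keyMeasureOn d W).real (B i j) :=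
          Finset.sum_le_sum fun i _ => measureReal_iUnion_fintype_le _
      _ ≤ ∑ _i : Fin N, ∑ _j : Fin N, Real.exp (-(q * εw) ^ 2 / (2 * q)) :=
          Finset.sum_le_sum fun i _ => Finset.sum_le_sum fun j _ => hBm i j
      _ = N * (N * Real.exp (-(q * εw) ^ 2 / (2 * q))) := by simp
      _ ≤ ω := sq_mul_exp_le hN hεw hω0 hω1 hq
  have hunion := measureReal_union_le (μ := keyMeasureOn d W) G (⋃ i, ⋃ j, B i j)
  change (keyMeasureOn d W).real G ≥ 1 - ω
  linarith
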